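/- arXiv:1203.5169 — 3 statements merged into one kernel-verified Lean document; each statement's English description precedes it below -/
import Mathlib

section
/- For every integer n ≥ 3 and every natural number h with 0 ≤ h ≤ n−1, a universal cycle for W(n,h) (the set of surjective functions from [n] onto {0,1,…,h} written as length-n words) exists if and only if n > h + 1. -/
/-- `W(n,h)`: the set of weak order words of length `n` with height exactly `h`,
i.e. words whose set of letters is exactly `{0, 1, …, h}`. -/
def heightWeakOrders (n h : ℕ) : Set (List ℕ) :=
  {w | w.length = n ∧ w.toFinset = Finset.range (h + 1)}

/-- `IsUCycle m N C a` says the cyclic sequence `a₀ a₁ … a_{N-1}` is a universal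
cycle for the set `C` of strings of length `m`: every cyclic window
`a_i a_{i+1} ⋯ a_{i+m-1}` (indices mod `N`) lies in `C`, and every element of `C`
arises from exactly one of the `N` cyclic windows. -/
def IsUCycle (m N : ℕ) (C : Set (List ℕ)) (a : ℕ → ℕ) : Prop :=
  (∀ i < N, (List.ofFn fun j : Fin m => a ((i + j.val) % N)) ∈ C) ∧
    ∀ c ∈ C, ∃! i, i < N ∧ (List.ofFn fun j : Fin m => a ((i + j.val) % N)) = c

namespace UCycle

section CycleJoining

variable {E : Type*}

/-- Precomposing with the transposition of two points on different cycles of `τ` puts both points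
on the same cycle. -/
theorem sameCycle_mul_swap [Finite E] [DecidableEq E] (τ : Equiv.Perm E) {x y : E}
    (hxy : ¬ τ.SameCycle x y) : (τ * Equiv.swap x y).SameCycle x y := by
  have hne : ∀ k : ℕ, (τ ^ k) y ≠ x := fun k hk =>
    hxy (Equiv.Perm.SameCycle.symm ⟨k, by simpa using hk⟩)
  have hex : ∃ k, 0 < k ∧ (τ ^ k) y = y :=
    ⟨orderOf τ, orderOf_pos τ, by simp [pow_orderOf_eq_one]⟩
  classical
  obtain ⟨hpos, hk⟩ := Nat.find_spec hex
  have key : ∀ j, j < Nat.find hex →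
      ((τ * Equiv.swap x y) ^ (j + 1)) x = (τ ^ (j + 1)) y := by
    intro j
    induction j with
    | zero => intro _; simp
    | succ j ih =>
      intro hj
      rw [pow_succ', Equiv.Perm.mul_apply, ih (by omega), pow_succ' τ (j + 1),
        Equiv.Perm.mul_apply, Equiv.Perm.mul_apply,
        Equiv.swap_apply_of_ne_of_ne (hne _) fun h => Nat.find_min hex hj ⟨by omega, h⟩]
  refine ⟨(Nat.find hex : ℕ), ?_⟩
  have := key (Nat.find hex - 1) (by omega)
  rw [Nat.sub_add_cancel hpos, hk] at this
  simpa using this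

/-- Joining two cycles of `τ` by a transposition only coarsens the cycle partition. -/
theorem SameCycle.mul_swap [Finite E] [DecidableEq E] {τ : Equiv.Perm E} {x y : E}
    (hxy : ¬ τ.SameCycle x y) {u v : E} (huv : τ.SameCycle u v) :
    (τ * Equiv.swap x y).SameCycle u v := by
  have hj := sameCycle_mul_swap τ hxy
  have step : ∀ z, (τ * Equiv.swap x y).SameCycle z (τ z) := by
    intro z
    have hz : (τ * Equiv.swap x y).SameCycle z (Equiv.swap x y z) := by
      rcases eq_or_ne z x with rfl | hx
      · simpa using hj
      rcases eq_or_ne z y with rfl | hy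
      · simpa using hj.symm
      · rw [Equiv.swap_apply_of_ne_of_ne hx hy]
    have := (Equiv.Perm.sameCycle_apply_right (f := τ * Equiv.swap x y)).2 hz
    simpa using this
  obtain ⟨k, rfl⟩ := huv.exists_nat_pow_eq
  induction k with
  | zero => exact Equiv.Perm.SameCycle.refl _ _
  | succ k ih =>
    rw [pow_succ', Equiv.Perm.mul_apply]
    exact (ih ⟨k, by simp⟩).trans (step _)

/-- Cycle joining: if no proper nonempty set is invariant under both the permutation `σ` and the
equivalence relation `r`, then `σ` can be modified within the classes of `r` to a single cycle. -/
theorem exists_forall_sameCycle_mul [Finite E] (r : Setoid E) (σ : Equiv.Perm E)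
    (hconn : ∀ S : Set E, S.Nonempty → (∀ x, σ x ∈ S ↔ x ∈ S) →
      (∀ x y, r x y → x ∈ S → y ∈ S) → S = Set.univ) :
    ∃ π : Equiv.Perm E, (∀ x, r x (π x)) ∧ ∀ x y, (σ * π).SameCycle x y := by
  classical
  rcases isEmpty_or_nonempty E with hE | ⟨⟨e⟩⟩
  · exact ⟨1, fun x => hE.elim x, fun x => hE.elim x⟩
  let P := {π : Equiv.Perm E // ∀ x, r x (π x)}
  have : Nonempty P := ⟨⟨1, fun x => r.refl x⟩⟩
  obtain ⟨⟨π, hπ⟩, hmax⟩ := Finite.exists_max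
    fun π : P => Set.ncard {y | (σ * π.1).SameCycle e y}
  have huniv : {y | (σ * π).SameCycle e y} = Set.univ := by
    by_contra hproper
    have : ¬ ∀ x y, r x y → (σ * π).SameCycle e x → (σ * π).SameCycle e y := by
      intro hr
      refine hproper (hconn _ ⟨e, Equiv.Perm.SameCycle.refl _ _⟩ (fun x => ?_) hr)
      have h1 : (σ * π).SameCycle e (π⁻¹ x) ↔ (σ * π).SameCycle e x := by
        have := hπ (π⁻¹ x)
        rw [Equiv.Perm.coe_inv, Equiv.apply_symm_apply] at this
        exact ⟨hr _ _ this, hr _ _ (r.symm this)⟩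
      have h2 := Equiv.Perm.sameCycle_apply_right (f := σ * π) (x := e) (y := π⁻¹ x)
      rw [Equiv.Perm.mul_apply, Equiv.Perm.coe_inv, Equiv.apply_symm_apply] at h2
      exact h2.trans h1
    push Not at this
    obtain ⟨x, y, hr, hx, hy⟩ := this
    have hxy : ¬ (σ * π).SameCycle x y := fun h => hy (hx.trans h)
    have hswap : ∀ z, r z (Equiv.swap x y z) := by
      intro z
      rcases eq_or_ne z x with rfl | hzx
      · simpa using hr
      rcases eq_or_ne z y with rfl | hzy
      · simpa using r.symm hr
      · rw [Equiv.swap_apply_of_ne_of_ne hzx hzy]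
    have hle := hmax ⟨π * Equiv.swap x y, fun z => r.trans (hswap z) (hπ _)⟩
    refine absurd hle (not_le.2 (Set.ncard_lt_ncard ?_ (Set.toFinite _)))
    simp only [← mul_assoc]
    exact ⟨fun z hz => SameCycle.mul_swap hxy hz, fun hsub =>
      hy (hsub ((SameCycle.mul_swap hxy hx).trans (sameCycle_mul_swap _ hxy)))⟩
  refine ⟨π, hπ, fun x y => ?_⟩
  have h : ∀ z, (σ * π).SameCycle e z := Set.eq_univ_iff_forall.1 huniv
  exact (h x).symm.trans (h y)

end CycleJoining

section Connectivity

open Function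

variable {ι κ : Type*}

/-- A surjection remains one when it is changed at a point whose value is also taken elsewhere. -/
theorem surjective_update [DecidableEq ι] {f : ι → κ} (hf : Surjective f) {p q : ι} (hpq : q ≠ p)
    (h : f q = f p) (v : κ) : Surjective (update f p v) := by
  intro c
  obtain ⟨x, rfl⟩ := hf c
  rcases eq_or_ne x p with rfl | hx
  · exact ⟨q, by rw [update_of_ne hpq, h]⟩
  · exact ⟨x, update_of_ne hx _ _⟩

/-- A family of surjections closed under surjective changes of a single value is closed under
swapping two values, provided that some value is taken twice. -/
theorem comp_swap_mem [DecidableEq ι] {T : Set (ι → κ)}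
    (hsurj : ∀ f ∈ T, Surjective f)
    (hT : ∀ f ∈ T, ∀ p v, Surjective (update f p v) → update f p v ∈ T)
    {f : ι → κ} (hf : f ∈ T) (hinj : ¬ Injective f) (p p' : ι) :
    f ∘ Equiv.swap p p' ∈ T := by
  have move : ∀ f ∈ T, ∀ p q v, q ≠ p → f q = f p → update f p v ∈ T :=
    fun f hf p q v hqp h => hT f hf p v (surjective_update (hsurj f hf) hqp h v)
  rcases eq_or_ne p p' with rfl | hpp
  · simpa using hf
  have redundant : ∀ p p' q : ι, p ≠ p' → q ≠ p → f q = f p → f ∘ Equiv.swap p p' ∈ T := by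
    intro p p' q hpp hqp h
    have h1 := move f hf p q (f p') hqp h
    have h2 := move _ h1 p' p (f p) hpp (by simp [update_of_ne hpp.symm])
    convert h2 using 1
    rw [Equiv.comp_swap_eq_update, update_comm hpp]
  have hex : ∃ q q', q ≠ q' ∧ f q = f q' := by
    unfold Injective at hinj
    push Not at hinj
    obtain ⟨q, q', h, hne⟩ := hinj
    exact ⟨q, q', hne, h⟩
  obtain ⟨q, q', hqq, hq⟩ := hex
  by_cases h1 : q = p
  · subst h1
    exact redundant q p' q' hpp hqq.symm hq.symm
  by_cases h2 : q = p'
  · subst h2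
    rw [Equiv.swap_comm]
    exact redundant q p q' hpp.symm hqq.symm hq.symm
  have s1 := move f hf q q' (f p) hqq.symm hq.symm
  have s2 := move _ s1 p q (f p') h1 (by simp [update_of_ne (Ne.symm h1)])
  have s3 := move _ s2 p' p (f p) hpp (by
    simp [update_of_ne hpp.symm, update_of_ne (Ne.symm h2)])
  have s4 := move _ s3 q p' (f q) (Ne.symm h2) (by
    simp [update_of_ne h2, update_of_ne h1])
  convert s4 using 1
  funext z
  simp only [comp_apply, Equiv.swap_apply_def, update_apply]
  split_ifs <;> simp_all

/-- Any two non-injective surjections are connected by surjective changes of single values. -/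
theorem mem_of_closed_update [Fintype ι] [DecidableEq ι] [DecidableEq κ] {T : Set (ι → κ)}
    (hsurj : ∀ f ∈ T, Surjective f) (hinj : ∀ f ∈ T, ¬ Injective f)
    (hT : ∀ f ∈ T, ∀ p v, Surjective (update f p v) → update f p v ∈ T)
    {g : ι → κ} (hg : Surjective g) (hne : T.Nonempty) : g ∈ T := by
  have main : ∀ d : ℕ, ∀ f ∈ T, hammingDist f g = d → g ∈ T := by
    intro d
    induction d using Nat.strong_induction_on with
    | _ d ih =>
      rintro f hf rfl
      by_cases hfg : f = g
      · exact hfg ▸ hf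
      obtain ⟨p, hp⟩ := Function.ne_iff.1 hfg
      by_cases hred : ∃ q, q ≠ p ∧ f q = f p
      · obtain ⟨q, hqp, hq⟩ := hred
        have hm := hT f hf p (g p) (surjective_update (hsurj f hf) hqp hq _)
        refine ih _ (Finset.card_lt_card ?_) _ hm rfl
        refine Finset.ssubset_iff_of_subset (fun z hz => ?_) |>.2 ⟨p, by simpa using hp, by simp⟩
        rcases eq_or_ne z p with rfl | hzp
        · simp at hz
        · simpa [update_of_ne hzp] using hz
      · push Not at hred
        obtain ⟨s, hs⟩ := hg (f p)
        have hsp : s ≠ p := by rintro rfl; exact hp hs.symm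
        have hm := comp_swap_mem hsurj hT hf (hinj f hf) p s
        refine ih _ (Finset.card_lt_card ?_) _ hm rfl
        refine Finset.ssubset_iff_of_subset (fun z hz => ?_) |>.2
          ⟨s, by simpa [hs] using hred s hsp, by simp [hs]⟩
        rcases eq_or_ne z p with rfl | hzp
        · simpa using hp
        rcases eq_or_ne z s with rfl | hzs
        · simp [hs] at hz
        · simpa [Equiv.swap_apply_of_ne_of_ne hzp hzs] using hz
  obtain ⟨f, hf⟩ := hne
  exact main _ f hf rfl

end Connectivity

/-- Surjections from `Fin n` onto `Fin (h + 1)`. -/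
abbrev Surj (n h : ℕ) : Type := {f : Fin n → Fin (h + 1) // Function.Surjective f}

/-- The word of values of a surjection. -/
def Surj.toList {n h : ℕ} (f : Surj n h) : List ℕ := List.ofFn fun j => (f.1 j : ℕ)

theorem Surj.toList_injective {n h : ℕ} : Function.Injective (Surj.toList (n := n) (h := h)) := by
  intro f g hfg
  have := List.ofFn_injective hfg
  exact Subtype.ext (funext fun j => Fin.ext (congrFun this j))

theorem Surj.toList_mem {n h : ℕ} (f : Surj n h) : f.toList ∈ heightWeakOrders n h := by
  refine ⟨by simp [Surj.toList], Finset.ext fun c => ?_⟩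
  simp only [Surj.toList, List.mem_toFinset, List.mem_ofFn, Finset.mem_range]
  constructor
  · rintro ⟨j, rfl⟩
    exact (f.1 j).2
  · intro hc
    obtain ⟨j, hj⟩ := f.2 ⟨c, hc⟩
    exact ⟨j, by simp [hj]⟩

theorem Surj.exists_toList_eq {n h : ℕ} {c : List ℕ} (hc : c ∈ heightWeakOrders n h) :
    ∃ f : Surj n h, f.toList = c := by
  obtain ⟨rfl, hset⟩ := hc
  have hmem : ∀ x, x ∈ c ↔ x < h + 1 := fun x => by
    rw [← List.mem_toFinset, hset, Finset.mem_range]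
  refine ⟨⟨fun j => ⟨c.get j, (hmem _).1 (c.get_mem j)⟩, fun v => ?_⟩, ?_⟩
  · obtain ⟨j, hj⟩ := List.mem_iff_get.1 ((hmem v).2 v.2)
    exact ⟨j, Fin.ext hj⟩
  · exact List.ofFn_get c

theorem card_heightWeakOrders (n h : ℕ) :
    Nat.card (heightWeakOrders n h) = Nat.card (Surj n h) := by
  refine (Nat.card_congr (Equiv.ofBijective
    (fun f : Surj n h => (⟨f.toList, f.toList_mem⟩ : heightWeakOrders n h)) ⟨?_, ?_⟩)).symm
  · intro f g hfg
    exact Surj.toList_injective (congrArg Subtype.val hfg)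
  · rintro ⟨c, hc⟩
    obtain ⟨f, hf⟩ := Surj.exists_toList_eq hc
    exact ⟨f, Subtype.ext hf⟩

/-- Cyclic rotation of words, as a permutation of the surjections. -/
def rotate (m h : ℕ) : Equiv.Perm (Surj (m + 1) h) where
  toFun f := ⟨fun j => f.1 (j + 1), f.2.comp (Equiv.addRight (1 : Fin (m + 1))).surjective⟩
  invFun f := ⟨fun j => f.1 (j - 1), f.2.comp (Equiv.subRight (1 : Fin (m + 1))).surjective⟩
  left_inv f := by simp
  right_inv f := by simp

/-- Words that agree except possibly in their first letter. -/
def tailSetoid (m h : ℕ) : Setoid (Surj (m + 1) h) where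
  r f g := ∀ j, j ≠ 0 → f.1 j = g.1 j
  iseqv := ⟨fun _ _ _ => rfl, fun H j hj => (H j hj).symm,
    fun H K j hj => (H j hj).trans (K j hj)⟩

open Fin.CommRing in
theorem rotate_pow_apply {m h : ℕ} (k : ℕ) (f : Surj (m + 1) h) (j : Fin (m + 1)) :
    ((rotate m h ^ k) f).1 j = f.1 (j + (k : Fin (m + 1))) := by
  induction k generalizing j with
  | zero => simp
  | succ k ih =>
    rw [pow_succ', Equiv.Perm.mul_apply]
    change ((rotate m h ^ k) f).1 (j + 1) = _
    rw [ih]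
    push_cast
    rw [add_assoc, add_comm (k : Fin (m + 1)) 1]

open Fin.CommRing in
theorem eq_univ_of_closed {m h : ℕ} (hmh : h < m) (S : Set (Surj (m + 1) h)) (hS : S.Nonempty)
    (hrot : ∀ f, rotate m h f ∈ S ↔ f ∈ S)
    (htail : ∀ f g, tailSetoid m h f g → f ∈ S → g ∈ S) : S = Set.univ := by
  have hpow : ∀ k f, (rotate m h ^ k) f ∈ S ↔ f ∈ S := by
    intro k f
    induction k with
    | zero => simp
    | succ k ih => rw [pow_succ', Equiv.Perm.mul_apply, hrot, ih]
  rw [Set.eq_univ_iff_forall]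
  rintro ⟨g, hg⟩
  have hmem : g ∈ Subtype.val '' S := by
    refine mem_of_closed_update ?_ ?_ ?_ hg (hS.image _)
    · rintro _ ⟨f, -, rfl⟩
      exact f.2
    · rintro _ ⟨f, -, rfl⟩ hinj
      have := Fintype.card_le_of_injective _ hinj
      simp at this
      omega
    · rintro _ ⟨f, hf, rfl⟩ p v hs
      refine ⟨⟨_, hs⟩, ?_, rfl⟩
      rw [← hpow p.val] at hf ⊢
      refine htail _ _ (fun j hj => ?_) hf
      rw [rotate_pow_apply, rotate_pow_apply, Fin.cast_val_eq_self]
      exact (Function.update_of_ne (by simpa using hj) _ _).symm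
  obtain ⟨f, hf, rfl⟩ := hmem
  exact hf

theorem exists_isUCycle {m h : ℕ} (hmh : h < m) :
    ∃ a : ℕ → ℕ, IsUCycle (m + 1) (Nat.card (heightWeakOrders (m + 1) h))
      (heightWeakOrders (m + 1) h) a := by
  classical
  obtain ⟨π, hπ, hcyc⟩ := exists_forall_sameCycle_mul (tailSetoid m h) (rotate m h)
    (eq_univ_of_closed hmh)
  set τ := rotate m h * π
  have hstep : ∀ f : Surj (m + 1) h, ∀ j (hj : j + 1 < m + 1),
      (τ f).1 ⟨j, by omega⟩ = f.1 ⟨j + 1, hj⟩ := by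
    intro f j hj
    have h1 : (τ f).1 ⟨j, by omega⟩ = (π f).1 (⟨j, by omega⟩ + 1) := rfl
    have h2 : (⟨j, by omega⟩ + 1 : Fin (m + 1)) = ⟨j + 1, hj⟩ := by
      ext
      rw [Fin.val_add_one_of_lt' (by simpa using hj)]
    rw [h1, h2]
    exact (hπ f _ (by simp [Fin.ext_iff])).symm
  have hiter : ∀ j (hj : j < m + 1) (f : Surj (m + 1) h), ((τ ^ j) f).1 0 = f.1 ⟨j, hj⟩ := by
    intro j
    induction j with
    | zero => intro _ f; rfl
    | succ j ih =>
      intro hj f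
      rw [pow_succ, Equiv.Perm.mul_apply, ih (by omega), hstep]
  have hcard : Nat.card (heightWeakOrders (m + 1) h) = (Finset.univ : Finset (Surj (m + 1) h)).card
    := by rw [card_heightWeakOrders, Nat.card_eq_fintype_card, Finset.card_univ]
  have hon : τ.IsCycleOn (Finset.univ : Finset (Surj (m + 1) h)) := by
    refine ⟨by simp [Set.bijOn_univ], fun x _ y _ => hcyc x y⟩
  have e : Surj (m + 1) h := by
    refine ⟨fun j => ⟨min j h, by omega⟩, fun v => ⟨⟨v, by omega⟩, Fin.ext ?_⟩⟩
    simpa using Nat.le_of_lt_succ v.2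
  have hwin : ∀ i, (List.ofFn fun j : Fin (m + 1) =>
      (((τ ^ ((i + j.val) % Nat.card (heightWeakOrders (m + 1) h))) e).1 0 : ℕ)) =
      ((τ ^ i) e).toList := by
    intro i
    refine congrArg List.ofFn (funext fun j => ?_)
    rw [hcard, (hon.pow_apply_eq_pow_apply (Finset.mem_univ e)).2 (Nat.mod_modEq _ _),
      Nat.add_comm i, pow_add, Equiv.Perm.mul_apply, hiter _ j.2]
  refine ⟨fun i => ((τ ^ i) e).1 0, fun i _ => ?_, fun c hc => ?_⟩
  · simp only [hwin]
    exact Surj.toList_mem _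
  · obtain ⟨f, rfl⟩ := Surj.exists_toList_eq hc
    simp only [hwin]
    obtain ⟨i, hi, rfl⟩ := hon.exists_pow_eq (Finset.mem_univ e) (Finset.mem_univ f)
    refine ⟨i, ⟨hcard ▸ hi, rfl⟩, ?_⟩
    rintro k ⟨hk, hki⟩
    have := (hon.pow_apply_eq_pow_apply (Finset.mem_univ e)).1 (Surj.toList_injective hki)
    exact Nat.ModEq.eq_of_lt_of_lt this (hcard ▸ hk) hi

/-- There is no universal cycle for the permutations of at least three letters. -/
theorem not_isUCycle_of_eq (m N : ℕ) (hm : 2 ≤ m) (a : ℕ → ℕ) :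
    ¬ IsUCycle (m + 1) N (heightWeakOrders (m + 1) m) a := by
  rintro ⟨hmem, hex⟩
  have hid := hex _ (Surj.toList_mem (⟨id, Function.surjective_id⟩ : Surj (m + 1) m))
  have hsw := hex _ (Surj.toList_mem
    (⟨Equiv.swap 0 1, (Equiv.swap 0 1).surjective⟩ : Surj (m + 1) m))
  obtain ⟨i, ⟨hi, hid⟩, -⟩ := hid
  obtain ⟨k, ⟨hk, hsw⟩, -⟩ := hsw
  have hN : 0 < N := by omega
  set b : ℕ → ℕ := fun x => a (x % N)
  have hwin : ∀ x, ∃ f : Surj (m + 1) m, ∀ j : Fin (m + 1), b (x + j) = f.1 j := by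
    intro x
    obtain ⟨f, hf⟩ := Surj.exists_toList_eq (hmem (x % N) (Nat.mod_lt _ hN))
    refine ⟨f, fun j => ?_⟩
    have := congrFun (List.ofFn_injective hf) j
    simp only [Nat.mod_add_mod] at this
    exact this.symm
  have hinj : ∀ x, ∀ j < m + 1, ∀ l < m + 1, b (x + j) = b (x + l) → j = l := by
    intro x j hj l hl hjl
    obtain ⟨f, hf⟩ := hwin x
    have h1 := hf ⟨j, hj⟩
    have h2 := hf ⟨l, hl⟩
    simp only at h1 h2
    rw [h1, h2] at hjl
    simpa using Finite.injective_iff_surjective.2 f.2 (Fin.ext hjl)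
  have hper : ∀ x, b (x + (m + 1)) = b x := by
    intro x
    obtain ⟨f, hf⟩ := hwin x
    obtain ⟨g, hg⟩ := hwin (x + 1)
    have hlast := hg ⟨m, by omega⟩
    obtain ⟨⟨j, hj⟩, hfj⟩ := f.2 (g.1 ⟨m, by omega⟩)
    have hj' := hf ⟨j, hj⟩
    rw [hfj, ← hlast] at hj'
    simp only at hj'
    rcases j with _ | j
    · rw [show x + (m + 1) = x + 1 + m by omega, ← hj', add_zero]
    · have := hinj (x + 1) j (by omega) m (by omega)
        (by rw [← hj']; congr 1; omega)
      omega
  have hmod : ∀ x y, b x = b y → x ≡ y [MOD (m + 1)] := by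
    have hred : ∀ x, b x = b (x % (m + 1)) := by
      have hp : Function.Periodic b (m + 1) := hper
      exact fun x => (hp.map_mod_nat x).symm
    intro x y hxy
    rw [hred x, hred y] at hxy
    exact hinj 0 _ (Nat.mod_lt _ (by omega)) _ (Nat.mod_lt _ (by omega)) (by simpa using hxy)
  have hidj : ∀ j : Fin (m + 1), b (i + j) = j := fun j => congrFun (List.ofFn_injective hid) j
  have hswj : ∀ j : Fin (m + 1), b (k + j) = Equiv.swap (0 : Fin (m + 1)) 1 j :=
    fun j => congrFun (List.ofFn_injective hsw) j
  have h0 := hmod (i + (0 : Fin (m + 1)).val) (k + (1 : Fin (m + 1)).val) (by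
    rw [hidj, hswj, Equiv.swap_apply_right])
  have h1 := hmod (i + (1 : Fin (m + 1)).val) (k + (0 : Fin (m + 1)).val) (by
    rw [hidj, hswj, Equiv.swap_apply_left])
  have hone : (1 : Fin (m + 1)).val = 1 := by
    rw [Fin.val_one']
    exact Nat.mod_eq_of_lt (by omega)
  rw [hone, Fin.val_zero] at h0 h1
  have h2 : k + 2 ≡ k + 0 [MOD (m + 1)] := (h0.symm.add_right 1).trans h1
  have h3 := (Nat.modEq_zero_iff_dvd).1 (Nat.ModEq.add_left_cancel' k h2)
  have := Nat.le_of_dvd (by omega) h3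
  omega

end UCycle

/-- For `n ≥ 3` and `0 ≤ h ≤ n - 1`, a universal cycle for `W(n,h)` (the
surjections from `[n]` onto `{0,…,h}` written as length-`n` words) exists if and
only if `n > h + 1`. -/
theorem exists_ucycle_heightWeakOrders_iff (n h : ℕ) (hn : 3 ≤ n) (hh : h ≤ n - 1) :
    (∃ a : ℕ → ℕ,
        IsUCycle n (Nat.card (heightWeakOrders n h)) (heightWeakOrders n h) a) ↔
      n > h + 1 := by
  obtain ⟨m, rfl⟩ : ∃ m, n = m + 1 := ⟨n - 1, by omega⟩
  constructor
  · rintro ⟨a, ha⟩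
    by_contra hlt
    obtain rfl : m = h := by omega
    exact UCycle.not_isUCycle_of_eq m _ (by omega) a ha
  · intro hlt
    exact UCycle.exists_isUCycle (by omega)
end

section
/- For all positive integers n, k and every natural number h with k ≤ n(n−1)/2, 0 ≤ h < n, and W_k(n,h) nonempty, there exists a universal cycle for W_k⁻(n,h), the set of prefixes of weight-k, height-h weak order words of length n (a set of strings of length n−1 whose cardinality equals |W_k(n,h)|). -/
/-- `W_k(n,h)`: the weak order words of length `n` with weight (sum of letters)
`k` and height exactly `h`. -/
def weightHeightWeakOrders (n k h : ℕ) : Set (List ℕ) :=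
  {w | w.length = n ∧ w.toFinset = Finset.range (h + 1) ∧ w.sum = k}

/-! ### Eulerian circuits -/

/-- Composing a permutation with a transposition of two points from different cycles merges these
cycles. -/
theorem Equiv.Perm.sameCycle_mul_swap_of_not_sameCycle {α : Type*} [Finite α] [DecidableEq α]
    {f : Equiv.Perm α} {x y : α} (hxy : ¬ f.SameCycle x y) :
    (f * Equiv.swap x y).SameCycle x y := by
  by_contra hcon
  set g := f * Equiv.swap x y with hg
  have hgx : g x = f y := by simp [hg]
  have hgo : ∀ a, a ≠ x → a ≠ y → g a = f a := fun a h1 h2 => by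
    simp [hg, Equiv.swap_apply_of_ne_of_ne h1 h2]
  have key : ∀ i : ℕ, g.SameCycle x ((f ^ (i + 1)) y) := by
    intro i
    induction i with
    | zero => rw [zero_add, pow_one, ← hgx]; exact Equiv.Perm.sameCycle_apply_right.2 (.refl _ _)
    | succ i ih =>
      have h1 : (f ^ (i + 1)) y ≠ x := fun h => by
        apply hxy
        rw [← h]
        exact Equiv.Perm.sameCycle_pow_left.2 (.refl _ _)
      have h2 : (f ^ (i + 1)) y ≠ y := fun h => by
        rw [h] at ih
        exact hcon ih
      rw [pow_succ', Equiv.Perm.mul_apply, ← hgo _ h1 h2]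
      exact Equiv.Perm.sameCycle_apply_right.2 ih
  have hord := key (orderOf f - 1)
  rw [Nat.sub_add_cancel (orderOf_pos f), pow_orderOf_eq_one] at hord
  exact hcon hord

/-- Merging two cycles by a transposition keeps points of a common cycle together. -/
theorem Equiv.Perm.SameCycle.mul_swap {α : Type*} [Finite α] [DecidableEq α]
    {f : Equiv.Perm α} {x y a b : α} (hxy : ¬ f.SameCycle x y) (hab : f.SameCycle a b) :
    (f * Equiv.swap x y).SameCycle a b := by
  have hs := Equiv.Perm.sameCycle_mul_swap_of_not_sameCycle hxy
  set g := f * Equiv.swap x y with hg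
  have hstep : ∀ c, g.SameCycle c (f c) := by
    intro c
    by_cases hcx : c = x
    · subst hcx
      have : g y = f c := by simp [hg]
      rw [← this]
      exact Equiv.Perm.sameCycle_apply_right.2 hs
    by_cases hcy : c = y
    · subst hcy
      have : g x = f c := by simp [hg]
      rw [← this]
      exact Equiv.Perm.sameCycle_apply_right.2 hs.symm
    have : g c = f c := by simp [hg, Equiv.swap_apply_of_ne_of_ne hcx hcy]
    rw [← this]
    exact Equiv.Perm.sameCycle_apply_right.2 (.refl _ _)
  obtain ⟨i, rfl⟩ := hab.exists_nat_pow_eq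
  clear hab
  induction i with
  | zero => exact .refl _ _
  | succ i ih =>
    rw [pow_succ', Equiv.Perm.mul_apply]
    exact ih.trans (hstep _)

/-- A finite directed multigraph with edge type `α`, which is balanced (as witnessed by a
permutation `f₀` sending each edge to an edge following it) and connected, has an Eulerian circuit.
Connectedness is expressed by saying that all functions on edges which agree on consecutive edges
are constant. -/
theorem exists_eulerian_perm {α β : Type*} [Finite α] (src tgt : α → β) (f₀ : Equiv.Perm α)
    (hf₀ : ∀ x, src (f₀ x) = tgt x)
    (hconn : ∀ φ : α → Set α, (∀ x y, tgt x = src y → φ x = φ y) → ∀ x y, φ x = φ y) :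
    ∃ f : Equiv.Perm α, (∀ x, src (f x) = tgt x) ∧ ∀ x y, f.SameCycle x y := by
  classical
  have : Nonempty {f : Equiv.Perm α // ∀ x, src (f x) = tgt x} := ⟨⟨f₀, hf₀⟩⟩
  obtain ⟨⟨f, hf⟩, hmax⟩ := Finite.exists_max
    (fun f : {f : Equiv.Perm α // ∀ x, src (f x) = tgt x} =>
      {p : α × α | f.1.SameCycle p.1 p.2}.ncard)
  refine ⟨f, hf, ?_⟩
  have htgt : ∀ x y, tgt x = tgt y → f.SameCycle x y := by
    intro x y hxy
    by_contra hcon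
    have hval : ∀ z, src ((f * Equiv.swap x y) z) = tgt z := by
      intro z
      rw [Equiv.Perm.mul_apply, hf, Equiv.swap_apply_def]
      split_ifs with h1 h2
      · rw [h1, hxy]
      · rw [h2, hxy]
      · rfl
    refine absurd (hmax ⟨_, hval⟩) (not_le.2 (Set.ncard_lt_ncard ?_ (Set.toFinite _)))
    refine Set.ssubset_iff_subset_ne.2 ⟨fun p hp => Equiv.Perm.SameCycle.mul_swap hcon hp, ?_⟩
    intro heq
    apply hcon
    have : (x, y) ∈ {p : α × α | (f * Equiv.swap x y).SameCycle p.1 p.2} :=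
      Equiv.Perm.sameCycle_mul_swap_of_not_sameCycle hcon
    rw [← heq] at this
    exact this
  have hall := hconn (fun x => {z | f.SameCycle x z}) (by
    intro x y hxy
    have h1 : f.SameCycle x (f.symm y) := htgt _ _ (by rw [hxy, ← hf]; simp)
    have h2 : f.SameCycle x y := by
      have := Equiv.Perm.sameCycle_apply_right.2 h1
      simpa using this
    ext z
    exact ⟨fun h => h2.symm.trans h, fun h => h2.trans h⟩)
  intro x y
  have : y ∈ {z | f.SameCycle y z} := .refl _ _
  rwa [← hall x y] at this

/-! ### Connectedness of the transition graph -/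

namespace weightHeightWeakOrders

variable {n k h : ℕ}

theorem mem_of_perm {u w : List ℕ} (huw : u.Perm w) (hu : u ∈ weightHeightWeakOrders n k h) :
    w ∈ weightHeightWeakOrders n k h :=
  ⟨huw.length_eq ▸ hu.1, List.toFinset_eq_of_perm _ _ huw ▸ hu.2.1, huw.sum_eq ▸ hu.2.2⟩

theorem finite (n k h : ℕ) : (weightHeightWeakOrders n k h).Finite := by
  refine ((List.finite_length_eq (Fin (h + 1)) n).image (List.map Fin.val)).subset ?_
  rintro w ⟨hlen, hsupp, -⟩
  have hlt : ∀ x ∈ w, x < h + 1 := fun x hx => by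
    rw [← List.mem_toFinset, hsupp] at hx
    exact Finset.mem_range.1 hx
  exact ⟨w.pmap Fin.mk hlt, by simp [hlen], by simp [List.map_pmap]⟩

theorem injOn_dropLast (n k h : ℕ) :
    Set.InjOn List.dropLast (weightHeightWeakOrders n k h) := by
  rintro u ⟨hu, -, hus⟩ w ⟨hw, -, hws⟩ huw
  rcases List.eq_nil_or_concat' u with rfl | ⟨u, a, rfl⟩ <;>
    rcases List.eq_nil_or_concat' w with rfl | ⟨w, b, rfl⟩ <;>
    simp only [List.length_append, List.length_nil, List.length_singleton, List.sum_append,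
      List.sum_singleton, List.dropLast_concat] at hu hw hus hws huw
  · rfl
  · omega
  · omega
  · subst huw
    rw [show a = b by omega]

/-- A function on lists which agrees on any two words of `weightHeightWeakOrders n k h` such that
the second is a possible successor of the first in a universal cycle for prefixes. -/
def IsSuccInvariant {γ : Type*} (n k h : ℕ) (φ : List ℕ → γ) : Prop :=
  ∀ a v b c d, a :: (v ++ [b]) ∈ weightHeightWeakOrders n k h →
    v ++ [c, d] ∈ weightHeightWeakOrders n k h → φ (a :: (v ++ [b])) = φ (v ++ [c, d])

namespace IsSuccInvariant

variable {γ : Type*} {φ : List ℕ → γ}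

theorem append_comm (hφ : IsSuccInvariant n k h φ) (l₁ l₂ : List ℕ)
    (hmem : l₁ ++ l₂ ∈ weightHeightWeakOrders n k h) : φ (l₁ ++ l₂) = φ (l₂ ++ l₁) := by
  induction l₁ generalizing l₂ with
  | nil => simp
  | cons a l ih =>
    have hstep : φ (a :: (l ++ l₂)) = φ ((l ++ l₂) ++ [a]) := by
      have hm : a :: (l ++ l₂) ∈ weightHeightWeakOrders n k h := hmem
      rcases List.eq_nil_or_concat' (l ++ l₂) with h0 | ⟨v, b, h0⟩
      · rw [h0]; rfl
      · rw [h0] at hm ⊢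
        rw [List.append_assoc]
        exact hφ a v b b a hm (mem_of_perm (by grind) hm)
    rw [List.cons_append, hstep, List.append_assoc, ih, List.append_assoc]
    · rfl
    · exact mem_of_perm (by grind) hmem

theorem perm (hφ : IsSuccInvariant n k h φ) {u w : List ℕ} (huw : u.Perm w) (l : List ℕ)
    (hmem : u ++ l ∈ weightHeightWeakOrders n k h) : φ (u ++ l) = φ (w ++ l) := by
  induction huw generalizing l with
  | nil => rfl
  | @cons x u w huw ih =>
    have hm : w ++ (l ++ [x]) ∈ weightHeightWeakOrders n k h :=
      mem_of_perm (by grind) hmem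
    have h1 := hφ.append_comm [x] (u ++ l) hmem
    have h2 := hφ.append_comm [x] (w ++ l) (mem_of_perm (by grind) hm)
    have h3 := ih (l ++ [x]) (mem_of_perm (by grind) hmem)
    simp only [List.cons_append, List.nil_append, List.append_assoc] at h1 h2 h3 ⊢
    rw [h1, h2, h3]
  | swap x y u =>
    have h1 := hφ.append_comm [y, x] (u ++ l) hmem
    have h2 := hφ.append_comm [x, y] (u ++ l) (mem_of_perm (by grind) hmem)
    have hm : y :: ((u ++ l) ++ [x]) ∈ weightHeightWeakOrders n k h :=
      mem_of_perm (by grind) hmem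
    have h3 := hφ y (u ++ l) x x y hm (mem_of_perm (by grind) hmem)
    have h4 := hφ y (u ++ l) x y x hm (mem_of_perm (by grind) hmem)
    exact h1.trans (h4.symm.trans (h3.trans h2.symm))
  | trans h₁ h₂ ih₁ ih₂ =>
    exact (ih₁ l hmem).trans (ih₂ l (mem_of_perm (h₁.append_right l) hmem))

theorem eq_of_perm (hφ : IsSuccInvariant n k h φ) {u w : List ℕ} (huw : u.Perm w)
    (hmem : u ∈ weightHeightWeakOrders n k h) : φ u = φ w := by
  simpa using hφ.perm huw [] (by simpa using hmem)

theorem replace_pair (hφ : IsSuccInvariant n k h φ) {u w v : List ℕ} {a b c d : ℕ}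
    (hu : u ∈ weightHeightWeakOrders n k h) (hw : w ∈ weightHeightWeakOrders n k h)
    (hua : u.Perm (a :: b :: v)) (hwc : w.Perm (c :: d :: v)) : φ u = φ w := by
  have h1 : u.Perm (a :: (v ++ [b])) := by grind
  have h2 : w.Perm (v ++ [c, d]) := by grind
  rw [hφ.eq_of_perm h1 hu, hφ.eq_of_perm h2 hw]
  exact hφ a v b c d (mem_of_perm h1 hu) (mem_of_perm h2 hw)

theorem append_mem_iff {base t : List ℕ} (hbase : base.toFinset = Finset.range (h + 1))
    (ht : ∀ x ∈ t, x ≤ h) :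
    base ++ t ∈ weightHeightWeakOrders n k h ↔
      base.length + t.length = n ∧ base.sum + t.sum = k := by
  have : (base ++ t).toFinset = Finset.range (h + 1) := by
    rw [List.toFinset_append, hbase, Finset.union_eq_left]
    intro x hx
    have := ht x (List.mem_toFinset.1 hx)
    rw [Finset.mem_range]
    omega
  simp [weightHeightWeakOrders, this]

theorem append_eq_append (hφ : IsSuccInvariant n k h φ) (m : ℕ) (base t t' : List ℕ)
    (hbase : base.toFinset = Finset.range (h + 1)) (ht : ∀ x ∈ t, x ≤ h) (ht' : ∀ x ∈ t', x ≤ h)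
    (hlt : t.length = m) (hlt' : t'.length = m)
    (hmem : base ++ t ∈ weightHeightWeakOrders n k h)
    (hmem' : base ++ t' ∈ weightHeightWeakOrders n k h) : φ (base ++ t) = φ (base ++ t') := by
  induction m generalizing base t t' with
  | zero =>
    rw [List.length_eq_zero_iff] at hlt hlt'
    rw [hlt, hlt']
  | succ m ih =>
    have main : ∀ d x s s', (∀ z ∈ x :: s, z ≤ h) → (∀ z ∈ (x + d) :: s', z ≤ h) →
        s.length = m → s'.length = m → base ++ x :: s ∈ weightHeightWeakOrders n k h →
        base ++ (x + d) :: s' ∈ weightHeightWeakOrders n k h →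
        φ (base ++ x :: s) = φ (base ++ (x + d) :: s') := by
      intro d
      induction d with
      | zero =>
        intro x s s' hs hs' hl hl' hm hm'
        have hx : x ≤ h := hs x (by simp)
        have hb : (base ++ [x]).toFinset = Finset.range (h + 1) := by
          rw [List.toFinset_append, hbase, Finset.union_eq_left]
          simp
          omega
        have := ih (base ++ [x]) s s' hb (fun z hz => hs z (by simp [hz]))
          (fun z hz => hs' z (by simp [hz])) hl hl' (by simpa using hm) (by simpa using hm')
        simpa using this
      | succ d ihd =>
        intro x s s' hs hs' hl hl' hm hm'
        have e1 := (append_mem_iff hbase hs).1 hm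
        have e2 := (append_mem_iff hbase hs').1 hm'
        have hxd : x + (d + 1) ≤ h := hs' _ (by simp)
        simp only [List.sum_cons] at e1 e2
        have hpos : s.sum ≠ 0 := by omega
        obtain ⟨z, hz, hz0⟩ : ∃ z ∈ s, z ≠ 0 := by
          by_contra! hcon
          exact hpos (List.sum_eq_zero hcon)
        obtain ⟨z, rfl⟩ := Nat.exists_eq_succ_of_ne_zero hz0
        have hperm := List.perm_cons_erase hz
        set r := s.erase z.succ
        have hle : ∀ y ∈ (x + 1) :: z :: r, y ≤ h := by
          intro y hy
          have hzs := hs z.succ (by simp [hz])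
          simp only [List.mem_cons] at hy
          rcases hy with rfl | rfl | hy
          · omega
          · omega
          · exact hs y (List.mem_cons_of_mem _ (hperm.mem_iff.2 (by simp [hy])))
        have hsum := hperm.sum_eq
        have hlen := hperm.length_eq
        simp only [List.sum_cons, List.length_cons] at hsum hlen e1 e2
        have hm2 : base ++ (x + 1) :: z :: r ∈ weightHeightWeakOrders n k h := by
          rw [append_mem_iff hbase hle]
          simp only [List.sum_cons, List.length_cons]
          omega
        have hmid : ∀ p q, (base ++ p :: q :: r).Perm (p :: q :: (base ++ r)) := fun p q =>
          List.perm_middle.trans (List.perm_middle.cons p)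
        have hstep : φ (base ++ x :: s) = φ (base ++ (x + 1) :: z :: r) :=
          hφ.replace_pair (a := x) (b := z.succ) (v := base ++ r) hm hm2
            (((hperm.cons x).append_left base).trans (hmid _ _)) (hmid _ _)
        have hcomm : x + (d + 1) = x + 1 + d := by omega
        rw [hstep]
        rw [hcomm] at hs' hm' ⊢
        exact ihd (x + 1) (z :: r) s' hle hs' (by simp; omega) hl' hm2 hm'
    obtain ⟨x, s, rfl⟩ := List.exists_cons_of_length_eq_add_one hlt
    obtain ⟨y, s', rfl⟩ := List.exists_cons_of_length_eq_add_one hlt'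
    simp only [List.length_cons, Nat.add_right_cancel_iff] at hlt hlt'
    rcases le_total x y with hxy | hxy
    · obtain ⟨d, rfl⟩ := Nat.exists_eq_add_of_le hxy
      exact main d x s s' ht ht' hlt hlt' hmem hmem'
    · obtain ⟨d, rfl⟩ := Nat.exists_eq_add_of_le hxy
      exact (main d y s' s ht' ht hlt' hlt hmem' hmem).symm

theorem eq_of_mem (hφ : IsSuccInvariant n k h φ) {u w : List ℕ}
    (hu : u ∈ weightHeightWeakOrders n k h) (hw : w ∈ weightHeightWeakOrders n k h) :
    φ u = φ w := by
  have split : ∀ v ∈ weightHeightWeakOrders n k h, ∃ t : List ℕ,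
      (List.range (h + 1) ++ t).Perm v ∧ ∀ x ∈ t, x ≤ h := by
    intro v hv
    have hsub : (List.range (h + 1)).Subperm v :=
      List.nodup_range.subperm fun x hx => by
        rw [← List.mem_toFinset, hv.2.1]
        simpa using hx
    have hp := List.subperm_append_diff_self_of_count_le fun x _ => hsub.count_le x
    refine ⟨_, hp, fun x hx => ?_⟩
    have : x ∈ v.toFinset := List.mem_toFinset.2 (hp.mem_iff.1 (List.mem_append_right _ hx))
    rw [hv.2.1, Finset.mem_range] at this
    omega
  obtain ⟨t, hpt, ht⟩ := split u hu
  obtain ⟨t', hpt', ht'⟩ := split w hw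
  have hl := hpt.length_eq
  have hl' := hpt'.length_eq
  rw [hu.1, List.length_append] at hl
  rw [hw.1, List.length_append] at hl'
  rw [hφ.eq_of_perm hpt.symm hu, hφ.eq_of_perm hpt'.symm hw]
  exact hφ.append_eq_append t.length _ t t' (by ext; simp) ht ht' rfl (by omega)
    (mem_of_perm hpt.symm hu) (mem_of_perm hpt'.symm hw)

end IsSuccInvariant

/-- The cyclic rotation of words by one letter. -/
noncomputable def rotatePerm (n k h : ℕ) : Equiv.Perm (weightHeightWeakOrders n k h) :=
  haveI := (finite n k h).to_subtype
  Equiv.ofBijective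
    (fun w => ⟨w.1.rotate 1, mem_of_perm (List.rotate_perm w.1 1).symm w.2⟩)
    (Finite.injective_iff_bijective.1 fun _ _ huw =>
      Subtype.ext (List.rotate_injective 1 (congrArg Subtype.val huw)))

/-- The words of `weightHeightWeakOrders n k h` can be arranged in a single cycle such that the
prefixes of consecutive words overlap in all but one letter. -/
theorem exists_cyclic_perm (n k h : ℕ) (hn : 2 ≤ n) :
    ∃ f : Equiv.Perm (weightHeightWeakOrders n k h),
      (∀ w, (f w).1.dropLast.dropLast = w.1.tail.dropLast) ∧ ∀ u w, f.SameCycle u w := by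
  have := (finite n k h).to_subtype
  refine exists_eulerian_perm (fun w : weightHeightWeakOrders n k h => w.1.dropLast.dropLast)
    (fun w => w.1.tail.dropLast) (rotatePerm n k h) ?_ ?_
  · rintro ⟨w, hw⟩
    obtain ⟨a, u, rfl⟩ : ∃ a u, w = a :: u :=
      List.exists_cons_of_ne_nil (List.ne_nil_of_length_pos (by have := hw.1; omega))
    simp [rotatePerm]
  · intro φ hφ u w
    let ψ : List ℕ → Set (Set (weightHeightWeakOrders n k h)) := fun l => {s | ∃ hl, s = φ ⟨l, hl⟩}
    have hψ : IsSuccInvariant n k h ψ := by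
      intro a v b c d h1 h2
      have := hφ ⟨_, h1⟩ ⟨_, h2⟩ (by simp [List.dropLast_append_of_ne_nil])
      ext s
      simp [ψ, h1, h2, this]
    have huw := hψ.eq_of_mem u.2 w.2
    have : φ u ∈ ψ u := ⟨u.2, rfl⟩
    rw [huw] at this
    exact this.2

end weightHeightWeakOrders

/-- For all positive integers `n, k` and natural `h` with `k ≤ C(n,2)`, `h < n`,
and `W_k(n,h)` nonempty, there is a universal cycle for `W_k⁻(n,h)`, the set of
prefixes (first `n-1` letters) of weight-`k`, height-`h` weak order words of
length `n`. -/
theorem exists_ucycle_weightHeightWeakOrders_prefixes (n k h : ℕ) (hn : 0 < n)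
    (hk : 0 < k) (hkn : k ≤ n.choose 2) (hh : h < n)
    (hne : (weightHeightWeakOrders n k h).Nonempty) :
    ∃ a : ℕ → ℕ,
      IsUCycle (n - 1) (Nat.card (List.dropLast '' weightHeightWeakOrders n k h))
        (List.dropLast '' weightHeightWeakOrders n k h) a := by
  have hn2 : 2 ≤ n := by
    by_contra hcon
    obtain rfl : n = 1 := by omega
    simp at hkn
    omega
  set W := weightHeightWeakOrders n k h with hW
  have := (weightHeightWeakOrders.finite n k h).to_subtype
  have := Fintype.ofFinite W
  obtain ⟨w₀, hw₀⟩ := hne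
  let x₀ : W := ⟨w₀, hw₀⟩
  obtain ⟨f, hf, hcyc⟩ := weightHeightWeakOrders.exists_cyclic_perm n k h hn2
  have hon : f.IsCycleOn ((Finset.univ : Finset W) : Set W) :=
    ⟨by simp, fun x _ y _ => hcyc x y⟩
  rw [Nat.card_image_of_injOn (weightHeightWeakOrders.injOn_dropLast n k h),
    Nat.card_eq_fintype_card, ← Finset.card_univ]
  set N := (Finset.univ : Finset W).card with hN
  let a : ℕ → ℕ := fun i => ((f ^ i) x₀).1.getD 0 0
  have hshift : ∀ (w : W) (j : ℕ), j + 2 < n → (f w).1.getD j 0 = w.1.getD (j + 1) 0 := by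
    intro w j hj
    have h1 := (f w).2.1
    have h2 := w.2.1
    have := congrArg (fun l : List ℕ => l.getD j 0) (hf w)
    simp only [List.getD_eq_getElem?_getD, List.getElem?_dropLast, List.getElem?_tail,
      List.length_dropLast, List.length_tail, h1, h2] at this
    rwa [if_pos (by omega), if_pos (by omega), if_pos (by omega)] at this
  have hletter : ∀ (j i : ℕ), j + 1 < n → a (i + j) = ((f ^ i) x₀).1.getD j 0 := by
    intro j
    induction j with
    | zero => intro i _; rfl
    | succ j ih =>
      intro i hj
      rw [← hshift _ _ (by omega), ← Equiv.Perm.mul_apply, ← pow_succ', ← ih (i + 1) (by omega)]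
      congr 1
      omega
  have hmod : ∀ i, a (i % N) = a i := by
    intro i
    have := (hon.pow_apply_eq_pow_apply (Finset.mem_univ x₀)).2 (Nat.mod_modEq i N)
    simp only [a, this]
  have hwin : ∀ i, (List.ofFn fun j : Fin (n - 1) => a ((i + j.val) % N)) =
      ((f ^ i) x₀).1.dropLast := by
    intro i
    have hl := ((f ^ i) x₀).2.1
    apply List.ext_getElem
    · simp [hl]
    · intro j h1 h2
      simp only [List.length_ofFn] at h1
      rw [List.getElem_ofFn, List.getElem_dropLast, hmod, hletter _ _ (by dsimp only; omega),
        List.getD_eq_getElem _ _ (by omega)]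
  refine ⟨a, fun i _ => ?_, ?_⟩
  · rw [hwin]
    exact ⟨_, ((f ^ i) x₀).2, rfl⟩
  · rintro _ ⟨w, hw, rfl⟩
    obtain ⟨i, hi, hiw⟩ := hon.exists_pow_eq (Finset.mem_univ x₀) (Finset.mem_univ ⟨w, hw⟩)
    refine ⟨i, ⟨hi, by rw [hwin, hiw]⟩, ?_⟩
    rintro i' ⟨hi', heq⟩
    rw [hwin] at heq
    have heq' : (f ^ i') x₀ = (f ^ i) x₀ := by
      rw [hiw]
      exact Subtype.ext
        (weightHeightWeakOrders.injOn_dropLast n k h ((f ^ i') x₀).2 hw heq)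
    have hmodeq := (hon.pow_apply_eq_pow_apply (Finset.mem_univ x₀)).1 heq'
    exact Nat.ModEq.eq_of_lt_of_lt hmodeq hi' hi
end

section
/- Let n, s, k be positive integers with 1 ≤ s ≤ n−2 and k ≤ n(n−1)/2. If gcd(s, n) = 1, then there exists an s-overlap cycle for W_k(n), the set of weight-k weak order words of length n. -/
/-- A word `w` over ℕ is a *weak order word* of length `n` if it has length `n`
and its set of letters is `{0, 1, …, h}` for some `h`. `weakOrders n` is the set
`W(n)` of all such words. -/
def weakOrders (n : ℕ) : Set (List ℕ) :=
  {w | w.length = n ∧ ∃ h : ℕ, w.toFinset = Finset.range (h + 1)}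

/-- `W_k(n)`: the weak order words of length `n` with weight (sum of letters) `k`. -/
def weightWeakOrders (n k : ℕ) : Set (List ℕ) :=
  {w ∈ weakOrders n | w.sum = k}

/-- `IsOCycle s N C f` says `f 0, f 1, …, f (N-1)` is an `s`-overlap cycle for the
set `C` of strings: it is a cyclic ordering of all elements of `C` (each occurring
exactly once) in which the last `s` letters of each word equal the first `s`
letters of the cyclically next word. -/
def IsOCycle (s N : ℕ) (C : Set (List ℕ)) (f : ℕ → List ℕ) : Prop :=
  (∀ i < N, f i ∈ C) ∧
    (∀ c ∈ C, ∃! i, i < N ∧ f i = c) ∧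
    ∀ i < N, (f i).drop ((f i).length - s) = (f ((i + 1) % N)).take s

namespace WeakOrderOCycle

open Equiv.Perm in
/-- Composing a permutation with the transposition of two points in different cycles merges
these cycles, and keeps all other points of a common cycle together. -/
theorem sameCycle_mul_swap {α : Type*} [Finite α] [DecidableEq α] {σ : Equiv.Perm α} {c d : α}
    (hcd : ¬ σ.SameCycle c d) :
    (σ * Equiv.swap c d).SameCycle c d ∧
      ∀ x y, σ.SameCycle x y → (σ * Equiv.swap c d).SameCycle x y := by
  set τ := σ * Equiv.swap c d with hτ
  have hc : τ c = σ d := by simp [hτ]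
  have hd : τ d = σ c := by simp [hτ]
  have hne : ∀ x, x ≠ c → x ≠ d → τ x = σ x := fun x h1 h2 => by
    simp [hτ, Equiv.swap_apply_of_ne_of_ne h1 h2]
  have key : τ.SameCycle c d := by
    by_contra hnot
    have h1 : ∀ i : ℕ, τ.SameCycle c ((σ ^ (i + 1)) d) := by
      intro i
      induction i with
      | zero =>
        rw [zero_add, pow_one, ← hc]
        exact sameCycle_apply_right.2 (SameCycle.refl _ _)
      | succ i ih =>
        have e1 : (σ ^ (i + 1)) d ≠ c := fun h => hcd (by
          have : σ.SameCycle ((σ ^ (i + 1)) d) d := sameCycle_pow_left.2 (SameCycle.refl _ _)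
          rwa [h] at this)
        have e2 : (σ ^ (i + 1)) d ≠ d := fun h => hnot (by rwa [h] at ih)
        rw [pow_succ', Equiv.Perm.mul_apply, ← hne _ e1 e2]
        exact sameCycle_apply_right.2 ih
    obtain ⟨m, hm⟩ := Nat.exists_eq_succ_of_ne_zero (orderOf_pos σ).ne'
    have h2 := h1 m
    rw [← Nat.succ_eq_add_one, ← hm, pow_orderOf_eq_one] at h2
    exact hnot h2
  have step : ∀ x, τ.SameCycle x (σ x) := by
    intro x
    by_cases h1 : x = c
    · rw [h1, ← hd]
      exact sameCycle_apply_right.2 key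
    by_cases h2 : x = d
    · rw [h2, ← hc]
      exact sameCycle_apply_right.2 key.symm
    rw [← hne x h1 h2]
    exact sameCycle_apply_right.2 (SameCycle.refl _ _)
  have steps : ∀ (i : ℕ) x, τ.SameCycle x ((σ ^ i) x) := by
    intro i
    induction i with
    | zero => exact fun x => SameCycle.refl _ _
    | succ i ih =>
      intro x
      rw [pow_succ', Equiv.Perm.mul_apply]
      exact (ih x).trans (step _)
  refine ⟨key, fun x y hxy => ?_⟩
  obtain ⟨i, rfl⟩ := hxy.exists_nat_pow_eq
  exact steps i x

/-- If some successor permutation for the arcs of a finite directed multigraph exists (so that the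
graph is balanced), then there is one for which any two arcs with a common endpoint lie on the
same closed trail. -/
theorem exists_perm_sameCycle {α β : Type*} [Finite α] (src tgt : α → β) (σ₀ : Equiv.Perm α)
    (h₀ : ∀ c, src (σ₀ c) = tgt c) :
    ∃ σ : Equiv.Perm α, (∀ c, src (σ c) = tgt c) ∧ ∀ c d, tgt c = tgt d → σ.SameCycle c d := by
  classical
  let g : Equiv.Perm α → ℕ := fun σ => Set.ncard {p : α × α | σ.SameCycle p.1 p.2}
  obtain ⟨σ, hσ, hmax⟩ := Set.exists_max_image {σ : Equiv.Perm α | ∀ c, src (σ c) = tgt c} g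
    (Set.toFinite _) ⟨σ₀, h₀⟩
  refine ⟨σ, hσ, fun c d hcd => ?_⟩
  by_contra hnot
  obtain ⟨h1, h2⟩ := sameCycle_mul_swap hnot
  have h3 : g (σ * Equiv.swap c d) ≤ g σ := by
    refine hmax _ fun x => ?_
    rw [Equiv.Perm.mul_apply, hσ]
    by_cases hxc : x = c
    · simp [hxc, hcd]
    by_cases hxd : x = d
    · simp [hxd, hcd]
    rw [Equiv.swap_apply_of_ne_of_ne hxc hxd]
  refine absurd h3 (not_le.2 (Set.ncard_lt_ncard ?_ (Set.toFinite _)))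
  refine ⟨fun p hp => h2 _ _ hp, fun hsub => hnot ?_⟩
  exact @hsub (c, d) h1

/-- A permutation with a single cycle lists all elements of a finite type. -/
theorem existsUnique_iterate_eq {α : Type*} [Finite α] (σ : Equiv.Perm α) (a : α)
    (h : ∀ b, σ.SameCycle a b) :
    σ^[Nat.card α] a = a ∧ ∀ b, ∃! i, i < Nat.card α ∧ σ^[i] a = b := by
  have hper : a ∈ Function.periodicPts σ := by
    refine ⟨orderOf σ, orderOf_pos σ, ?_⟩
    rw [Function.IsPeriodicPt, Function.IsFixedPt, ← Equiv.Perm.coe_pow, pow_orderOf_eq_one]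
    rfl
  have hpos := Function.minimalPeriod_pos_of_mem_periodicPts hper
  have hbij : Function.Bijective
      (fun i : Fin (Function.minimalPeriod σ a) => σ^[(i : ℕ)] a) := by
    constructor
    · intro i j hij
      exact Fin.ext ((Function.iterate_eq_iterate_iff_of_lt_minimalPeriod i.2 j.2).1 hij)
    · intro b
      obtain ⟨i, hi⟩ := (h b).exists_nat_pow_eq
      refine ⟨⟨i % Function.minimalPeriod σ a, Nat.mod_lt _ hpos⟩, ?_⟩
      rw [Equiv.Perm.coe_pow] at hi
      simpa [Function.iterate_mod_minimalPeriod_eq] using hi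
  have hcard : Nat.card α = Function.minimalPeriod σ a := by
    rw [← Nat.card_congr (Equiv.ofBijective _ hbij), Nat.card_fin]
  rw [hcard]
  refine ⟨Function.iterate_minimalPeriod, fun b => ?_⟩
  obtain ⟨i, hi⟩ := hbij.2 b
  refine ⟨i, ⟨i.2, hi⟩, fun j hj => ?_⟩
  exact (Function.iterate_eq_iterate_iff_of_lt_minimalPeriod hj.1 i.2).1 (hj.2.trans hi.symm)

theorem mem_weightWeakOrders_of_perm {n k : ℕ} {v w : List ℕ} (h : v.Perm w)
    (hv : v ∈ weightWeakOrders n k) : w ∈ weightWeakOrders n k := by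
  obtain ⟨⟨h1, m, h2⟩, h3⟩ := hv
  exact ⟨⟨h.length_eq ▸ h1, m, by rw [← h2, List.toFinset_eq_of_perm _ _ h]⟩, h.sum_eq ▸ h3⟩

theorem finite_weightWeakOrders (n k : ℕ) : (weightWeakOrders n k).Finite := by
  refine ((List.finite_length_eq (Fin (k + 1)) n).image (List.map Fin.val)).subset ?_
  rintro w ⟨⟨h1, -⟩, h2⟩
  have hlt : ∀ x ∈ w, x < k + 1 := fun x hx =>
    Nat.lt_succ_of_le (h2 ▸ List.le_sum_of_mem hx)
  refine ⟨w.pmap Fin.mk hlt, by simpa using h1, ?_⟩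
  simp [List.map_pmap]

/-- The words `0 1 … h a 0 … 0`, where the letter `a` is dropped when it is `0`. -/
def stair (h a q : ℕ) : List ℕ :=
  List.range (h + 1) ++ ((if a = 0 then [] else [a]) ++ List.replicate q 0)

theorem sum_range_succ_mul_two (h : ℕ) : (List.range (h + 1)).sum * 2 = h * (h + 1) := by
  induction h with
  | zero => simp
  | succ h ih =>
    rw [List.range_succ, List.sum_append, add_mul, ih]
    simp
    ring

theorem stair_eq_stair {h a q h' a' q' : ℕ} (ha : a ≤ h) (ha' : a' ≤ h')
    (hlen : (stair h a q).length = (stair h' a' q').length)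
    (hsum : (stair h a q).sum = (stair h' a' q').sum) : stair h a q = stair h' a' q' := by
  have e : ∀ h a q, (stair h a q).sum * 2 = h * (h + 1) + 2 * a := by
    intro h a q
    have := sum_range_succ_mul_two h
    by_cases h0 : a = 0 <;> simp only [stair, h0, List.sum_append, List.sum_replicate] <;>
      simp <;> omega
  have h1 : h * (h + 1) + 2 * a = h' * (h' + 1) + 2 * a' := by rw [← e h a q, hsum, e]
  have hh : h = h' := by
    rcases lt_trichotomy h h' with hlt | heq | hlt
    · nlinarith
    · exact heq
    · nlinarith
  subst hh
  have haa : a = a' := by omega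
  subst haa
  have : q = q' := by simpa [stair] using hlen
  rw [this]

/-- A partial equivalence relation that relates words of `weightWeakOrders n k` with the same
`s`-letter prefix, and each word to its rotation by `n - s`. -/
structure IsConnecting (n s k : ℕ) (R : List ℕ → List ℕ → Prop) : Prop where
  symm : ∀ v w, R v w → R w v
  trans : ∀ u v w, R u v → R v w → R u w
  of_take_eq : ∀ v ∈ weightWeakOrders n k, ∀ w ∈ weightWeakOrders n k,
    v.take s = w.take s → R v w
  rotate_sub : ∀ w ∈ weightWeakOrders n k, R w (w.rotate (n - s))

namespace IsConnecting

variable {n s k : ℕ} {R : List ℕ → List ℕ → Prop}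

theorem refl (hR : IsConnecting n s k R) {w : List ℕ} (hw : w ∈ weightWeakOrders n k) : R w w :=
  hR.of_take_eq w hw w hw rfl

theorem rotate (hR : IsConnecting n s k R) (hs : s < n) (hgcd : Nat.gcd s n = 1)
    {w : List ℕ} (hw : w ∈ weightWeakOrders n k) (m : ℕ) : R w (w.rotate m) := by
  have h1 : ∀ i, R w (w.rotate ((i + 1) * (n - s))) := by
    intro i
    induction i with
    | zero => simpa using hR.rotate_sub w hw
    | succ i ih =>
      have := hR.rotate_sub _
        (mem_weightWeakOrders_of_perm (List.rotate_perm w ((i + 1) * (n - s))).symm hw)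
      rw [List.rotate_rotate] at this
      have e : (i + 1 + 1) * (n - s) = (i + 1) * (n - s) + (n - s) := by ring
      rw [e]
      exact hR.trans _ _ _ ih this
  have hlen : w.length = n := hw.1.1
  have hcop : Nat.Coprime (n - s) n := by
    rw [Nat.coprime_self_sub_left hs.le]
    exact hgcd
  obtain ⟨j, hj⟩ : ∃ j, (n - s) * j ≡ m [MOD n] := by
    obtain ⟨j, hj⟩ := Nat.exists_mul_mod_eq_of_coprime m hcop (by omega)
    exact ⟨j, hj.2⟩
  have hmod : ((j + (n - 1)) + 1) * (n - s) ≡ m [MOD n] := by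
    have e : ((j + (n - 1)) + 1) * (n - s) = (n - s) * j + n * (n - s) := by
      rw [add_assoc, Nat.sub_add_cancel (by omega)]
      ring
    rw [e]
    exact (Nat.add_modulus_mul_modEq_iff (n := n)).2 hj
  have := h1 (j + (n - 1))
  rw [← List.rotate_mod, hlen, hmod, ← hlen, List.rotate_mod] at this
  exact this

theorem cons_cons (hR : IsConnecting n s k R) (hs : s + 2 ≤ n) (hgcd : Nat.gcd s n = 1)
    {a b c d : ℕ} {p : List ℕ} (h₁ : a :: b :: p ∈ weightWeakOrders n k)
    (h₂ : c :: d :: p ∈ weightWeakOrders n k) : R (a :: b :: p) (c :: d :: p) := by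
  have hlen : p.length + 2 = n := h₁.1.1
  have e : ∀ x y : ℕ, (x :: y :: p).rotate 2 = p ++ [x, y] := fun x y =>
    List.rotate_append_length_eq [x, y] p
  have r1 := hR.rotate (by omega) hgcd h₁ 2
  have r2 := hR.rotate (by omega) hgcd h₂ 2
  have m1 := mem_weightWeakOrders_of_perm (List.rotate_perm _ 2).symm h₁
  have m2 := mem_weightWeakOrders_of_perm (List.rotate_perm _ 2).symm h₂
  rw [e] at r1 r2 m1 m2
  refine hR.trans _ _ _ r1 (hR.trans _ _ _ (hR.of_take_eq _ m1 _ m2 ?_) (hR.symm _ _ r2))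
  rw [List.take_append_of_le_length (by omega), List.take_append_of_le_length (by omega)]

theorem append_swap (hR : IsConnecting n s k R) (hs : s + 2 ≤ n) (hgcd : Nat.gcd s n = 1)
    {a b : ℕ} {x y : List ℕ} (h : x ++ a :: b :: y ∈ weightWeakOrders n k) :
    R (x ++ a :: b :: y) (x ++ b :: a :: y) := by
  have h' : x ++ b :: a :: y ∈ weightWeakOrders n k :=
    mem_weightWeakOrders_of_perm ((List.Perm.swap b a y).append_left x) h
  have r1 := hR.rotate (by omega) hgcd h x.length
  have r2 := hR.rotate (by omega) hgcd h' x.length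
  have m1 := mem_weightWeakOrders_of_perm (List.rotate_perm _ x.length).symm h
  have m2 := mem_weightWeakOrders_of_perm (List.rotate_perm _ x.length).symm h'
  rw [List.rotate_append_length_eq] at r1 r2 m1 m2
  exact hR.trans _ _ _ r1 (hR.trans _ _ _ (hR.cons_cons hs hgcd m1 m2) (hR.symm _ _ r2))

theorem of_perm (hR : IsConnecting n s k R) (hs : s + 2 ≤ n) (hgcd : Nat.gcd s n = 1)
    {v w : List ℕ} (h : v.Perm w) (hv : v ∈ weightWeakOrders n k) : R v w := by
  have key : ∀ x : List ℕ, x ++ v ∈ weightWeakOrders n k → R (x ++ v) (x ++ w) := by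
    clear hv
    induction h with
    | nil => exact fun x hx => hR.refl hx
    | cons a _ ih =>
      intro x hx
      simpa using ih (x ++ [a]) (by simpa using hx)
    | swap a b l => exact fun x hx => hR.append_swap hs hgcd hx
    | trans h₁ _ ih₁ ih₂ =>
      exact fun x hx => hR.trans _ _ _ (ih₁ x hx)
        (ih₂ x (mem_weightWeakOrders_of_perm (h₁.append_left x) hx))
  simpa using key [] (by simpa using hv)

end IsConnecting

/-- Up to permutation, a weak order word is a staircase word, or it contains two nonzero letters
that can be moved apart without leaving the set of weak order words. -/
theorem exists_perm_stair_or {n k : ℕ} {w : List ℕ} (hw : w ∈ weightWeakOrders n k) :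
    (∃ h a q, a ≤ h ∧ w.Perm (stair h a q)) ∨
      ∃ a b p, a + 1 ≤ b ∧ w.Perm ((a + 1) :: b :: p) ∧
        a :: (b + 1) :: p ∈ weightWeakOrders n k := by
  obtain ⟨⟨hlen, h, hh⟩, hsum⟩ := id hw
  have hmem : ∀ x, x ∈ w ↔ x ≤ h := by
    intro x
    rw [← List.mem_toFinset, hh, Finset.mem_range, Nat.lt_succ_iff]
  obtain ⟨E, hE⟩ : ∃ E, w.Perm (List.range (h + 1) ++ E) := by
    have hsub : (List.range (h + 1)).Subperm w :=
      List.nodup_range.subperm fun x hx => (hmem x).2 (by simpa [Nat.lt_succ_iff] using hx)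
    obtain ⟨l, hl, hlw⟩ := hsub
    obtain ⟨E, hE⟩ := hlw.exists_perm_append
    exact ⟨E, hE.trans (hl.append_right E)⟩
  obtain ⟨F, q, hF, hF0⟩ : ∃ F q, E.Perm (F ++ List.replicate q 0) ∧ ∀ x ∈ F, x ≠ 0 := by
    refine ⟨E.filter (fun x => x ≠ 0), (E.filter (fun x => ! decide (x ≠ 0))).length, ?_, ?_⟩
    · rw [← List.eq_replicate_of_mem (a := 0) (l := E.filter (fun x => ! decide (x ≠ 0)))]
      · exact (List.filter_append_perm _ E).symm
      · simp
    · simp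
  have hw' : w.Perm (List.range (h + 1) ++ (F ++ List.replicate q 0)) :=
    hE.trans (hF.append_left _)
  have hFle : ∀ x ∈ F, x ≤ h := fun x hx => (hmem x).1 (hw'.mem_iff.2 (by simp [hx]))
  match F, hF0, hFle, hw' with
  | [], _, _, hw' => exact Or.inl ⟨h, 0, q, Nat.zero_le _, by simpa [stair] using hw'⟩
  | [a], h0, hle, hw' =>
    exact Or.inl ⟨h, a, q, hle a (by simp), by simpa [stair, h0 a (by simp)] using hw'⟩
  | x :: y :: t, h0, hle, hw' =>
    right
    obtain ⟨a, b, hab, hbh, hp⟩ : ∃ a b, a + 1 ≤ b ∧ b ≤ h ∧ [x, y].Perm [a + 1, b] := by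
      have hx0 := h0 x (by simp)
      have hy0 := h0 y (by simp)
      rcases le_total x y with hxy | hxy
      · refine ⟨x - 1, y, by omega, hle y (by simp), ?_⟩
        rw [Nat.sub_add_cancel (by omega)]
      · refine ⟨y - 1, x, by omega, hle x (by simp), ?_⟩
        rw [Nat.sub_add_cancel (by omega)]
        exact List.Perm.swap _ _ _
    set p := List.range (h + 1) ++ (t ++ List.replicate q 0) with hpdef
    have hperm : w.Perm ((a + 1) :: b :: p) := by
      refine hw'.trans ?_
      have e1 : (List.range (h + 1) ++ (x :: y :: t ++ List.replicate q 0)).Perm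
          ([x, y] ++ p) := by
        have : x :: y :: t ++ List.replicate q 0 = [x, y] ++ (t ++ List.replicate q 0) := by simp
        rw [this, hpdef, ← List.append_assoc, ← List.append_assoc [x, y]]
        exact List.perm_append_comm.append_right _
      exact e1.trans (hp.append_right p)
    refine ⟨a, b, p, hab, hperm, ⟨?_, ?_⟩, ?_⟩
    · rw [← hlen, hperm.length_eq]
      rfl
    · have hp1 : ∀ z, z ≤ h → z ∈ p := fun z hz => by
        simp [hpdef, hz]
      have hp2 : ∀ z ∈ p, z ≤ h := fun z hz => (hmem z).1 (hperm.mem_iff.2 (by simp [hz]))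
      have hp3 : ∀ z, z ∈ p ↔ z ≤ h := fun z => ⟨hp2 z, hp1 z⟩
      refine ⟨max h (b + 1), ?_⟩
      ext z
      simp only [List.mem_toFinset, List.mem_cons, hp3, Finset.mem_range]
      omega
    · rw [← hsum, hperm.sum_eq]
      simp only [List.sum_cons]
      omega

namespace IsConnecting

variable {n s k : ℕ} {R : List ℕ → List ℕ → Prop}

theorem exists_stair (hR : IsConnecting n s k R) (hs : s + 2 ≤ n) (hgcd : Nat.gcd s n = 1)
    {w : List ℕ} (hw : w ∈ weightWeakOrders n k) :
    ∃ h a q, a ≤ h ∧ stair h a q ∈ weightWeakOrders n k ∧ R w (stair h a q) := by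
  have hbound : ∀ v : List ℕ, (v.map (· ^ 2)).sum ≤ v.sum ^ 2 := by
    intro v
    induction v with
    | nil => simp
    | cons a v ih =>
      simp only [List.map_cons, List.sum_cons]
      nlinarith [Nat.zero_le (a * v.sum)]
  induction hm : k ^ 2 - (w.map (· ^ 2)).sum using Nat.strong_induction_on generalizing w with
  | _ m ih =>
    rcases exists_perm_stair_or hw with ⟨h, a, q, ha, hp⟩ | ⟨a, b, p, hab, hp, hv⟩
    · exact ⟨h, a, q, ha, mem_weightWeakOrders_of_perm hp hw, hR.of_perm hs hgcd hp hw⟩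
    · have hlt : (w.map (· ^ 2)).sum < ((a :: (b + 1) :: p).map (· ^ 2)).sum := by
        rw [(hp.map _).sum_eq]
        simp only [List.map_cons, List.sum_cons]
        nlinarith
      have hle := hbound (a :: (b + 1) :: p)
      rw [hv.2] at hle
      obtain ⟨h, c, q, hc, hmem, hrel⟩ := ih _ (by omega) hv rfl
      refine ⟨h, c, q, hc, hmem, hR.trans _ _ _ (hR.of_perm hs hgcd hp hw) ?_⟩
      exact hR.trans _ _ _
        (hR.cons_cons hs hgcd (mem_weightWeakOrders_of_perm hp hw) hv) hrel

theorem rel (hR : IsConnecting n s k R) (hs : s + 2 ≤ n) (hgcd : Nat.gcd s n = 1)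
    {v w : List ℕ} (hv : v ∈ weightWeakOrders n k) (hw : w ∈ weightWeakOrders n k) : R v w := by
  obtain ⟨h, a, q, ha, hm, hr⟩ := hR.exists_stair hs hgcd hv
  obtain ⟨h', a', q', ha', hm', hr'⟩ := hR.exists_stair hs hgcd hw
  rw [stair_eq_stair ha ha' (hm.1.1.trans hm'.1.1.symm) (hm.2.trans hm'.2.symm)] at hr
  exact hR.trans _ _ _ hr (hR.symm _ _ hr')

end IsConnecting

/-- Rotation by `n - s` letters, as a permutation of `weightWeakOrders n k`. -/
def rotateEquiv (n s k : ℕ) (hs : s ≤ n) : Equiv.Perm (weightWeakOrders n k) where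
  toFun w := ⟨w.1.rotate (n - s), mem_weightWeakOrders_of_perm (List.rotate_perm _ _).symm w.2⟩
  invFun w := ⟨w.1.rotate s, mem_weightWeakOrders_of_perm (List.rotate_perm _ _).symm w.2⟩
  left_inv w := by
    refine Subtype.ext ?_
    have hlen : w.1.length = n := w.2.1.1
    simp only [List.rotate_rotate]
    rw [Nat.sub_add_cancel hs]
    exact (congrArg _ hlen.symm).trans (List.rotate_length w.1)
  right_inv w := by
    refine Subtype.ext ?_
    have hlen : w.1.length = n := w.2.1.1
    simp only [List.rotate_rotate]
    rw [Nat.add_sub_cancel' hs]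
    exact (congrArg _ hlen.symm).trans (List.rotate_length w.1)

theorem take_rotateEquiv {n s k : ℕ} (hs : s ≤ n) (w : weightWeakOrders n k) :
    (rotateEquiv n s k hs w).1.take s = w.1.drop (n - s) := by
  have hlen : w.1.length = n := w.2.1.1
  simp only [rotateEquiv, Equiv.coe_fn_mk]
  rw [List.rotate_eq_drop_append_take (by omega), List.take_append_of_le_length,
    List.take_of_length_le]
  all_goals simp; omega

end WeakOrderOCycle

/-- For positive integers `n, s, k` with `1 ≤ s ≤ n - 2`, `k ≤ C(n,2)` and
`gcd(s,n) = 1`, there exists an `s`-overlap cycle for `W_k(n)`. -/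
theorem exists_ocycle_weightWeakOrders (n s k : ℕ) (hn : 0 < n) (hk : 0 < k)
    (hs1 : 1 ≤ s) (hs2 : s ≤ n - 2) (hkn : k ≤ n.choose 2)
    (hgcd : Nat.gcd s n = 1) :
    ∃ f : ℕ → List ℕ,
      IsOCycle s (Nat.card (weightWeakOrders n k)) (weightWeakOrders n k) f := by
  have hsn : s + 2 ≤ n := by omega
  have hle : s ≤ n := by omega
  have : Finite (weightWeakOrders n k) := WeakOrderOCycle.finite_weightWeakOrders n k
  rcases isEmpty_or_nonempty (weightWeakOrders n k) with hempty | ⟨⟨w₀⟩⟩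
  · exact ⟨fun _ => [], by simp, fun c hc => (hempty.false ⟨c, hc⟩).elim, by simp⟩
  obtain ⟨σ, hσ, hcyc⟩ := WeakOrderOCycle.exists_perm_sameCycle
    (fun w : weightWeakOrders n k => w.1.take s) (fun w => w.1.drop (n - s))
    (WeakOrderOCycle.rotateEquiv n s k hle) (WeakOrderOCycle.take_rotateEquiv hle)
  have hcyc' : ∀ c d : weightWeakOrders n k, c.1.take s = d.1.take s → σ.SameCycle c d := by
    intro c d hcd
    have := hcyc (σ.symm c) (σ.symm d) (by rw [← hσ, ← hσ]; simpa using hcd)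
    simpa using Equiv.Perm.sameCycle_apply_left.2 (Equiv.Perm.sameCycle_apply_right.2 this)
  have hR : WeakOrderOCycle.IsConnecting n s k
      (fun v w => ∃ hv hw, σ.SameCycle ⟨v, hv⟩ ⟨w, hw⟩) := by
    refine ⟨?_, ?_, ?_, ?_⟩
    · rintro v w ⟨hv, hw, h⟩
      exact ⟨hw, hv, h.symm⟩
    · rintro u v w ⟨hu, hv, h⟩ ⟨_, hw, h'⟩
      exact ⟨hu, hw, h.trans h'⟩
    · exact fun v hv w hw h => ⟨hv, hw, hcyc' _ _ h⟩
    · intro w hw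
      refine ⟨hw, (WeakOrderOCycle.rotateEquiv n s k hle ⟨w, hw⟩).2, ?_⟩
      refine Equiv.Perm.sameCycle_apply_left.1 (hcyc' _ _ ?_)
      exact (hσ _).trans (WeakOrderOCycle.take_rotateEquiv hle ⟨w, hw⟩).symm
  have hall : ∀ w, σ.SameCycle w₀ w := fun w => (hR.rel hsn hgcd w₀.2 w.2).2.2
  obtain ⟨hclose, huniq⟩ := WeakOrderOCycle.existsUnique_iterate_eq σ w₀ hall
  refine ⟨fun i => (σ^[i] w₀).1, fun i _ => (σ^[i] w₀).2, fun c hc => ?_, fun i hi => ?_⟩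
  · simpa [Subtype.ext_iff] using huniq ⟨c, hc⟩
  · have hnext : σ^[(i + 1) % Nat.card (weightWeakOrders n k)] w₀ = σ (σ^[i] w₀) := by
      rw [← Function.iterate_succ_apply' σ i w₀]
      rcases (Nat.succ_le_of_lt hi).lt_or_eq with h | h
      · rw [Nat.mod_eq_of_lt h]
      · rw [Nat.succ_eq_add_one] at h ⊢
        rw [h, Nat.mod_self, hclose]
        rfl
    simp only [hnext]
    rw [hσ, (σ^[i] w₀).2.1.1]
end
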